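/- Assume G ∈ L¹(D × D) is symmetric and positive semidefinite as a kernel (∫_D∫_D G(x,y) u(x) u(y) dx dy ≥ 0 for every bounded measurable u). Let ω^λ = λ(1_{Ω₁} − 1_{Ω₂}) be a maximizer of E over K_λ, with Ω_i ⊆ B_i measurable, i = 1,2. Assume the nondegeneracy property: there exists δ₁ > 0 such that for every ω̃ in the rearrangement class F_{ω^λ} with ‖ω̃ − ω^λ‖_{L¹(D)} < δ₁, writing ψ̃(x) = ∫_D G(x,y) ω̃(y) dy, there exist ν₁ > 0 and ν₂ > 0 with |{ψ̃ > ν₁}| = |Ω₁|, |{ψ̃ < −ν₂}| = |Ω₂|, {ψ̃ > ν₁} ⊆ B₁ and {ψ̃ < −ν₂} ⊆ B₂. Then ω^λ is a local maximizer of E relative to F_{ω^λ}: every ω̃ ∈ F_{ω^λ} with ‖ω̃ − ω^λ‖_{L¹(D)} < δ₁ satisfies E(ω̃) ≤ E(ω^λ). -/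

import Mathlib

open MeasureTheory Metric Set Filter Topology Real

noncomputable section

abbrev Pt : Type := EuclideanSpace ℝ (Fin 2)

def IsAdmissiblePair (D B1 B2 : Set Pt) (κ1 κ2 lam : ℝ) (ω1 ω2 : Pt → ℝ) : Prop :=
  Measurable ω1 ∧ Measurable ω2 ∧
  (∀ᵐ x ∂(volume.restrict D), 0 ≤ ω1 x ∧ ω1 x ≤ lam) ∧
  (∀ᵐ x ∂(volume.restrict D), -lam ≤ ω2 x ∧ ω2 x ≤ 0) ∧
  (∫ x in D, ω1 x) = κ1 ∧ (∫ x in D, ω2 x) = κ2 ∧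
  (∀ᵐ x ∂(volume.restrict D), x ∉ B1 → ω1 x = 0) ∧
  (∀ᵐ x ∂(volume.restrict D), x ∉ B2 → ω2 x = 0)

def InK (D B1 B2 : Set Pt) (κ1 κ2 lam : ℝ) (ω : Pt → ℝ) : Prop :=
  ∃ ω1 ω2 : Pt → ℝ, ω =ᵐ[volume.restrict D] ω1 + ω2 ∧
    IsAdmissiblePair D B1 B2 κ1 κ2 lam ω1 ω2

def energy (D : Set Pt) (G : Pt → Pt → ℝ) (ω : Pt → ℝ) : ℝ :=
  (1 / 2) * ∫ x in D, ∫ y in D, G x y * ω x * ω y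

/-- The rearrangement class of `ω` on `D`. -/
def rearrCl (D : Set Pt) (ω : Pt → ℝ) : Set (Pt → ℝ) :=
  {v | Measurable v ∧ ∀ a : ℝ, volume {x ∈ D | a < v x} = volume {x ∈ D | a < ω x}}

theorem map_eq_of_measure_Ioi_eq {X : Type*} [MeasurableSpace X] {μ : Measure X}
    [IsFiniteMeasure μ] {f g : X → ℝ} (hf : Measurable f) (hg : Measurable g)
    (h : ∀ a, μ {x | a < f x} = μ {x | a < g x}) : μ.map f = μ.map g := by
  refine ext_of_generate_finite (Set.range Ioi) (borel_eq_generateFrom_Ioi ℝ ▸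
    (BorelSpace.measurable_eq (α := ℝ))) isPiSystem_Ioi ?_ ?_
  · rintro _ ⟨a, rfl⟩
    rw [Measure.map_apply hf measurableSet_Ioi, Measure.map_apply hg measurableSet_Ioi]
    exact h a
  · rw [Measure.map_apply hf MeasurableSet.univ, Measure.map_apply hg MeasurableSet.univ]
    rfl

theorem integrable_kernel_mul {X : Type*} [MeasurableSpace X] {μ : Measure X} [SFinite μ]
    {G : X → X → ℝ} (hG : Integrable (fun p : X × X => G p.1 p.2) (μ.prod μ))
    {f g : X → ℝ} (hf : Measurable f) (hg : Measurable g) {C : ℝ}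
    (hfC : ∀ x, |f x| ≤ C) (hgC : ∀ x, |g x| ≤ C) :
    Integrable (fun p : X × X => G p.1 p.2 * f p.1 * g p.2) (μ.prod μ) := by
  have h1 : Integrable (fun p : X × X => G p.1 p.2 * f p.1) (μ.prod μ) :=
    hG.mul_bdd (c := C) (hf.comp measurable_fst).aestronglyMeasurable
      (Eventually.of_forall fun p => hfC p.1)
  exact h1.mul_bdd (c := C) (hg.comp measurable_snd).aestronglyMeasurable
    (Eventually.of_forall fun p => hgC p.2)

theorem quadratic_le_of_potential_le {X : Type*} [MeasurableSpace X] {μ : Measure X} [SFinite μ]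
    {G : X → X → ℝ} (hG : Integrable (fun p : X × X => G p.1 p.2) (μ.prod μ))
    (hsym : ∀ x y, G x y = G y x)
    (hpsd : ∀ u : X → ℝ, Measurable u → (∃ M, ∀ x, |u x| ≤ M) →
      0 ≤ ∫ x, ∫ y, G x y * u x * u y ∂μ ∂μ)
    {v w : X → ℝ} (hv : Measurable v) (hw : Measurable w) {C : ℝ}
    (hvC : ∀ x, |v x| ≤ C) (hwC : ∀ x, |w x| ≤ C)
    (h : ∫ x, (∫ y, G x y * w y ∂μ) * w x ∂μ ≤ ∫ x, (∫ y, G x y * w y ∂μ) * v x ∂μ) :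
    ∫ x, ∫ y, G x y * w x * w y ∂μ ∂μ ≤ ∫ x, ∫ y, G x y * v x * v y ∂μ ∂μ := by
  have hpot : ∀ f : X → ℝ, ∫ x, (∫ y, G x y * w y ∂μ) * f x ∂μ =
      ∫ x, ∫ y, G x y * f x * w y ∂μ ∂μ := fun f => by
    congr 1; ext x
    rw [← integral_mul_const]
    congr 1; ext y; ring
  rw [hpot, hpot] at h
  have hvv := integrable_kernel_mul hG hv hv hvC hvC
  have hvw := integrable_kernel_mul hG hv hw hvC hwC
  have hwv := integrable_kernel_mul hG hw hv hwC hvC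
  have hww := integrable_kernel_mul hG hw hw hwC hwC
  have hu := hpsd (fun x => v x - w x) (hv.sub hw)
    ⟨C + C, fun x => (abs_sub _ _).trans (add_le_add (hvC x) (hwC x))⟩
  have huu : Integrable (fun p : X × X => G p.1 p.2 * (v p.1 - w p.1) * (v p.2 - w p.2))
      (μ.prod μ) := by
    refine (((hvv.sub hvw).sub hwv).add hww).congr (Eventually.of_forall fun p => ?_)
    simp only [Pi.add_apply, Pi.sub_apply]; ring
  have hswap : ∫ p : X × X, G p.1 p.2 * w p.1 * v p.2 ∂(μ.prod μ) =
      ∫ p : X × X, G p.1 p.2 * v p.1 * w p.2 ∂(μ.prod μ) := by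
    rw [← integral_prod_swap]
    refine integral_congr_ae (Eventually.of_forall fun p => ?_)
    simp only [Prod.fst_swap, Prod.snd_swap]
    rw [hsym p.2 p.1]; ring
  have key : ∫ p : X × X, G p.1 p.2 * (v p.1 - w p.1) * (v p.2 - w p.2) ∂(μ.prod μ) =
      ∫ p : X × X, G p.1 p.2 * v p.1 * v p.2 ∂(μ.prod μ)
      - ∫ p : X × X, G p.1 p.2 * v p.1 * w p.2 ∂(μ.prod μ)
      - ∫ p : X × X, G p.1 p.2 * w p.1 * v p.2 ∂(μ.prod μ)
      + ∫ p : X × X, G p.1 p.2 * w p.1 * w p.2 ∂(μ.prod μ) := by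
    rw [← integral_sub' hvv hvw, ← integral_sub' (hvv.sub hvw) hwv,
      ← integral_add' ((hvv.sub hvw).sub hwv) hww]
    refine integral_congr_ae (Eventually.of_forall fun p => ?_)
    simp only [Pi.add_apply, Pi.sub_apply]; ring
  rw [← integral_prod _ huu] at hu
  rw [← integral_prod _ hww, ← integral_prod _ hvv]
  rw [← integral_prod _ hww, ← integral_prod _ hvw] at h
  linarith

/-- The bathtub principle, for two-signed functions bounded by `lam`. -/
theorem integral_mul_le_integral_mul_superlevel {X : Type*} [MeasurableSpace X] {μ : Measure X}
    [IsFiniteMeasure μ] {ψ w : X → ℝ} (hψ : Integrable ψ μ) (hw : Measurable w) {lam : ℝ}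
    (hlam : 0 ≤ lam) (hwC : ∀ x, |w x| ≤ lam) {A₁ A₂ : Set X} (hA₁ : MeasurableSet A₁)
    (hA₂ : MeasurableSet A₂) {ν₁ ν₂ : ℝ} (h₁ : ∀ᵐ x ∂μ, x ∈ A₁ ↔ ν₁ < ψ x)
    (h₂ : ∀ᵐ x ∂μ, x ∈ A₂ ↔ ψ x < -ν₂)
    (hpos : ∫ x, max (w x) 0 ∂μ = lam * μ.real A₁)
    (hneg : ∫ x, max (-w x) 0 ∂μ = lam * μ.real A₂) :
    ∫ x, ψ x * w x ∂μ ≤ ∫ x, ψ x * (lam * (A₁.indicator 1 x - A₂.indicator 1 x)) ∂μ := by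
  have hwi : Integrable w μ :=
    Integrable.of_bound hw.aestronglyMeasurable lam (Eventually.of_forall hwC)
  have hi₁ : Integrable (A₁.indicator (1 : X → ℝ)) μ := (integrable_const 1).indicator hA₁
  have hi₂ : Integrable (A₂.indicator (1 : X → ℝ)) μ := (integrable_const 1).indicator hA₂
  have hpi : Integrable (fun x => max (w x) 0) μ := hwi.pos_part
  have hni : Integrable (fun x => max (-w x) 0) μ := hwi.neg_part
  have hψw : Integrable (fun x => ψ x * w x) μ :=
    hψ.mul_bdd (c := lam) hw.aestronglyMeasurable (Eventually.of_forall hwC)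
  have hmi : Measurable fun x => lam * (A₁.indicator (1 : X → ℝ) x - A₂.indicator 1 x) :=
    ((measurable_one.indicator hA₁).sub (measurable_one.indicator hA₂)).const_mul lam
  have hψv : Integrable
      (fun x => ψ x * (lam * (A₁.indicator (1 : X → ℝ) x - A₂.indicator 1 x))) μ := by
    refine hψ.mul_bdd (c := lam) hmi.aestronglyMeasurable (Eventually.of_forall fun x => ?_)
    rw [Real.norm_eq_abs, abs_le]
    by_cases a : x ∈ A₁ <;> by_cases b : x ∈ A₂ <;> simp [a, b] <;> linarith
  have hp : Integrable (fun x => ν₁ * (lam * A₁.indicator 1 x - max (w x) 0)) μ :=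
    ((hi₁.const_mul lam).sub hpi).const_mul ν₁
  have hn : Integrable (fun x => ν₂ * (lam * A₂.indicator 1 x - max (-w x) 0)) μ :=
    ((hi₂.const_mul lam).sub hni).const_mul ν₂
  have hzero : ∫ x, (ν₁ * (lam * A₁.indicator 1 x - max (w x) 0) +
      ν₂ * (lam * A₂.indicator 1 x - max (-w x) 0)) ∂μ = 0 := by
    rw [integral_add hp hn, integral_const_mul, integral_const_mul,
      integral_sub (hi₁.const_mul lam) hpi, integral_sub (hi₂.const_mul lam) hni,
      integral_const_mul, integral_const_mul, integral_indicator_one hA₁,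
      integral_indicator_one hA₂, hpos, hneg]
    ring
  have hle : ∫ x, (ν₁ * (lam * A₁.indicator 1 x - max (w x) 0) +
      ν₂ * (lam * A₂.indicator 1 x - max (-w x) 0)) ∂μ ≤
      ∫ x, (ψ x * (lam * (A₁.indicator 1 x - A₂.indicator 1 x)) - ψ x * w x) ∂μ := by
    refine integral_mono_ae (hp.add hn) (hψv.sub hψw) ?_
    filter_upwards [h₁, h₂] with x h₁ h₂
    have hC := abs_le.1 (hwC x)
    have hsplit : w x = max (w x) 0 - max (-w x) 0 := by
      rcases le_total 0 (w x) with h | h <;> simp [h]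
    have hp0 : 0 ≤ max (w x) 0 := le_max_right _ _
    have hn0 : 0 ≤ max (-w x) 0 := le_max_right _ _
    have hpl : max (w x) 0 ≤ lam := max_le hC.2 hlam
    have hnl : max (-w x) 0 ≤ lam := max_le (by linarith) hlam
    have e₁ : 0 ≤ (ψ x - ν₁) * (lam * A₁.indicator 1 x - max (w x) 0) := by
      by_cases a : x ∈ A₁
      · have := h₁.1 a
        simp only [a, indicator_of_mem, Pi.one_apply]
        exact mul_nonneg (by linarith) (by linarith)
      · have := not_lt.1 (mt h₁.2 a)
        simp only [a, not_false_eq_true, indicator_of_notMem]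
        exact mul_nonneg_of_nonpos_of_nonpos (by linarith) (by linarith)
    have e₂ : 0 ≤ (-ψ x - ν₂) * (lam * A₂.indicator 1 x - max (-w x) 0) := by
      by_cases a : x ∈ A₂
      · have := h₂.1 a
        simp only [a, indicator_of_mem, Pi.one_apply]
        exact mul_nonneg (by linarith) (by linarith)
      · have := not_lt.1 (mt h₂.2 a)
        simp only [a, not_false_eq_true, indicator_of_notMem]
        exact mul_nonneg_of_nonpos_of_nonpos (by linarith) (by linarith)
    generalize max (w x) 0 = p at *
    generalize max (-w x) 0 = n at *
    rw [hsplit]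
    linarith
  rw [hzero, integral_sub hψv hψw] at hle
  linarith

theorem exists_measurableSet_subset_ae_iff {D : Set Pt} (hD : MeasurableSet D) {p : Pt → Prop}
    (hp : NullMeasurableSet {x | p x} (volume.restrict D)) :
    ∃ A ⊆ {x ∈ D | p x}, MeasurableSet A ∧ (∀ᵐ x ∂(volume.restrict D), x ∈ A ↔ p x) ∧
      volume A = volume {x ∈ D | p x} := by
  obtain ⟨A, hsub, hA, hae⟩ := (hD.nullMeasurableSet.inter hp).exists_measurable_subset_ae_eq
  refine ⟨A, hsub, hA, ?_, ?_⟩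
  · filter_upwards [hae.mem_iff, ae_restrict_mem hD] with x hx hxD
    rw [hx]
    exact ⟨fun h => h.2, fun h => ⟨hxD, h⟩⟩
  · have h := measure_congr hae
    rwa [Measure.restrict_apply' hD, Measure.restrict_apply' hD,
      inter_eq_left.2 (hsub.trans inter_subset_left), inter_eq_left.2 inter_subset_left] at h

theorem integral_const_mul_indicator_one {D A : Set Pt} (hA : MeasurableSet A) (hAD : A ⊆ D)
    (c : ℝ) : ∫ x in D, c * A.indicator 1 x = c * volume.real A := by
  rw [integral_const_mul, integral_indicator_one hA, measureReal_restrict_apply hA,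
    inter_eq_left.2 hAD]

theorem inK_of_indicator {D B₁ B₂ : Set Pt} {lam : ℝ} (hlam : 0 ≤ lam) {A₁ A₂ : Set Pt}
    (hA₁ : MeasurableSet A₁) (hA₂ : MeasurableSet A₂) (h₁ : A₁ ⊆ B₁) (h₂ : A₂ ⊆ B₂)
    (hB₁ : B₁ ⊆ D) (hB₂ : B₂ ⊆ D) :
    InK D B₁ B₂ (lam * volume.real A₁) (-lam * volume.real A₂) lam
      (fun x => lam * (A₁.indicator 1 x - A₂.indicator 1 x)) := by
  refine ⟨fun x => lam * A₁.indicator 1 x, fun x => -lam * A₂.indicator 1 x,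
    Eventually.of_forall fun x => by simp only [Pi.add_apply]; ring,
    (measurable_one.indicator hA₁).const_mul _, (measurable_one.indicator hA₂).const_mul _,
    Eventually.of_forall fun x => ?_, Eventually.of_forall fun x => ?_,
    integral_const_mul_indicator_one hA₁ (h₁.trans hB₁) _,
    integral_const_mul_indicator_one hA₂ (h₂.trans hB₂) _,
    Eventually.of_forall fun x hx => ?_, Eventually.of_forall fun x hx => ?_⟩
  · by_cases a : x ∈ A₁ <;> simp [a, hlam]
  · by_cases a : x ∈ A₂ <;> simp [a, hlam]
  · simp [indicator_of_notMem (notMem_subset h₁ hx)]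
  · simp [indicator_of_notMem (notMem_subset h₂ hx)]

theorem eq_of_inK_indicator {D B₁ B₂ : Set Pt} {κ₁ κ₂ lam : ℝ} {A₁ A₂ : Set Pt}
    (hA₁ : MeasurableSet A₁) (hA₂ : MeasurableSet A₂) (h₁ : A₁ ⊆ B₁) (h₂ : A₂ ⊆ B₂)
    (hB₁ : B₁ ⊆ D) (hB₂ : B₂ ⊆ D) (hB : Disjoint B₁ B₂)
    (h : InK D B₁ B₂ κ₁ κ₂ lam (fun x => lam * (A₁.indicator 1 x - A₂.indicator 1 x))) :
    κ₁ = lam * volume.real A₁ ∧ κ₂ = -lam * volume.real A₂ := by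
  obtain ⟨ω₁, ω₂, hae, -, -, -, -, rfl, rfl, hs₁, hs₂⟩ := h
  rw [← integral_const_mul_indicator_one hA₁ (h₁.trans hB₁),
    ← integral_const_mul_indicator_one hA₂ (h₂.trans hB₂)]
  constructor
  · refine integral_congr_ae ?_
    filter_upwards [hae, hs₁, hs₂] with x hx hs₁ hs₂
    by_cases b : x ∈ B₁
    · have b₂ := disjoint_left.1 hB b
      simp only [Pi.add_apply, hs₂ b₂,
        indicator_of_notMem (notMem_subset h₂ b₂)] at hx
      linarith
    · simp [hs₁ b, indicator_of_notMem (notMem_subset h₁ b)]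
  · refine integral_congr_ae ?_
    filter_upwards [hae, hs₁, hs₂] with x hx hs₁ hs₂
    by_cases b : x ∈ B₂
    · have b₁ := disjoint_right.1 hB b
      simp only [Pi.add_apply, hs₁ b₁,
        indicator_of_notMem (notMem_subset h₁ b₁)] at hx
      linarith
    · simp [hs₂ b, indicator_of_notMem (notMem_subset h₂ b)]

theorem energy_congr {D : Set Pt} {G : Pt → Pt → ℝ} {f g : Pt → ℝ}
    (h : f =ᵐ[volume.restrict D] g) : energy D G f = energy D G g := by
  unfold energy
  congr 1
  refine integral_congr_ae ?_
  filter_upwards [h] with x hx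
  refine integral_congr_ae ?_
  filter_upwards [h] with y hy
  rw [hx, hy]

theorem stmt16
    (D : Set Pt) (hDo : IsOpen D) (hDb : Bornology.IsBounded D)
    (xb1 xb2 : Pt) (hx : xb1 ≠ xb2) (δ : ℝ) (hδ : 0 < δ)
    (hB1D : closedBall xb1 δ ⊆ D) (hB2D : closedBall xb2 δ ⊆ D)
    (hBdisj : Disjoint (closedBall xb1 δ) (closedBall xb2 δ))
    (κ1 κ2 : ℝ) (hκ1 : 0 < κ1) (hκ2 : κ2 < 0)
    (G : Pt → Pt → ℝ)
    (hG : IntegrableOn (fun p : Pt × Pt => G p.1 p.2) (D ×ˢ D))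
    (hGsym : ∀ x y, G x y = G y x)
    (hGpsd : ∀ u : Pt → ℝ, Measurable u → (∃ M, ∀ x, |u x| ≤ M) →
      0 ≤ ∫ x in D, ∫ y in D, G x y * u x * u y)
    (lam : ℝ) (hlam : 0 < lam)
    (Ω1 Ω2 : Set Pt) (hΩ1 : MeasurableSet Ω1) (hΩ2 : MeasurableSet Ω2)
    (hΩ1B : Ω1 ⊆ closedBall xb1 δ) (hΩ2B : Ω2 ⊆ closedBall xb2 δ)
    (ωl : Pt → ℝ)
    (hform : ωl = fun x => lam * (Ω1.indicator 1 x - Ω2.indicator 1 x))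
    (hmem : InK D (closedBall xb1 δ) (closedBall xb2 δ) κ1 κ2 lam ωl)
    (hmax : ∀ ω, InK D (closedBall xb1 δ) (closedBall xb2 δ) κ1 κ2 lam ω →
      energy D G ω ≤ energy D G ωl)
    (δ1 : ℝ) (hδ1 : 0 < δ1)
    (hnd : ∀ ω' ∈ rearrCl D ωl, (∫ x in D, |ω' x - ωl x|) < δ1 →
      ∀ ψ' : Pt → ℝ, (∀ x, ψ' x = ∫ y in D, G x y * ω' y) →
      ∃ ν1 > 0, ∃ ν2 > 0,
        volume {x ∈ D | ν1 < ψ' x} = volume Ω1 ∧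
        volume {x ∈ D | ψ' x < -ν2} = volume Ω2 ∧
        {x ∈ D | ν1 < ψ' x} ⊆ closedBall xb1 δ ∧
        {x ∈ D | ψ' x < -ν2} ⊆ closedBall xb2 δ) :
    ∀ ω' ∈ rearrCl D ωl, (∫ x in D, |ω' x - ωl x|) < δ1 →
      energy D G ω' ≤ energy D G ωl := by
  intro ω' hω' hclose
  have hD := hDo.measurableSet
  have : IsFiniteMeasure (volume.restrict D) :=
    isFiniteMeasure_restrict.2 hDb.measure_lt_top.ne
  obtain ⟨ν1, -, ν2, -, hv1, hv2, hsub1, hsub2⟩ :=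
    hnd ω' hω' hclose (fun x => ∫ y in D, G x y * ω' y) fun _ => rfl
  obtain ⟨hω'm, hω'v⟩ := hω'
  have hωlm : Measurable ωl := by
    rw [hform]
    exact ((measurable_one.indicator hΩ1).sub (measurable_one.indicator hΩ2)).const_mul lam
  have hmap : (volume.restrict D).map ω' = (volume.restrict D).map ωl := by
    refine map_eq_of_measure_Ioi_eq hω'm hωlm fun a => ?_
    rw [Measure.restrict_apply' hD, Measure.restrict_apply' hD, inter_comm, inter_comm _ D]
    exact hω'v a
  have hωlC : ∀ x, |ωl x| ≤ lam := fun x => by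
    rw [abs_le, hform]
    by_cases a : x ∈ Ω1 <;> by_cases b : x ∈ Ω2 <;> simp [a, b] <;> linarith
  have hω'C : ∀ᵐ x ∂(volume.restrict D), |ω' x| ≤ lam := by
    have hs : MeasurableSet {t : ℝ | |t| ≤ lam} := measurableSet_le measurable_abs measurable_const
    rw [← ae_map_iff (p := fun t : ℝ => |t| ≤ lam) hω'm.aemeasurable hs, hmap,
      ae_map_iff hωlm.aemeasurable hs]
    exact Eventually.of_forall hωlC
  have hint : ∀ φ : ℝ → ℝ, Measurable φ → ∫ x in D, φ (ω' x) = ∫ x in D, φ (ωl x) := by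
    intro φ hφ
    rw [← integral_map hω'm.aemeasurable hφ.aestronglyMeasurable, hmap,
      integral_map hωlm.aemeasurable hφ.aestronglyMeasurable]
  have hΩdisj : ∀ x, x ∈ Ω1 → x ∉ Ω2 := fun x h h' =>
    disjoint_left.1 hBdisj (hΩ1B h) (hΩ2B h')
  have hlpos : ∫ x in D, max (ωl x) 0 = lam * volume.real Ω1 := by
    rw [← integral_const_mul_indicator_one hΩ1 (hΩ1B.trans hB1D), hform]
    congr 1; ext x
    by_cases a : x ∈ Ω1
    · simp [a, hΩdisj x a, hlam.le]
    · by_cases b : x ∈ Ω2 <;> simp [a, b, hlam.le]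
  have hlneg : ∫ x in D, max (-ωl x) 0 = lam * volume.real Ω2 := by
    rw [← integral_const_mul_indicator_one hΩ2 (hΩ2B.trans hB2D), hform]
    congr 1; ext x
    by_cases a : x ∈ Ω1
    · simp [a, hΩdisj x a, hlam.le]
    · by_cases b : x ∈ Ω2 <;> simp [a, b, hlam.le]
  -- a representative of `ω'` bounded on the whole plane
  obtain ⟨w, hwm, hwC, hwae⟩ : ∃ w : Pt → ℝ, Measurable w ∧ (∀ x, |w x| ≤ lam) ∧
      ω' =ᵐ[volume.restrict D] w := by
    refine ⟨fun x => max (-lam) (min lam (ω' x)), by fun_prop, fun x => ?_, ?_⟩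
    · exact abs_le.2 ⟨le_max_left _ _, max_le (by linarith) (min_le_left _ _)⟩
    · filter_upwards [hω'C] with x hx
      have := abs_le.1 hx
      rw [min_eq_right this.2, max_eq_right this.1]
  have hψw : ∀ x, ∫ y in D, G x y * ω' y = ∫ y in D, G x y * w y := fun x =>
    integral_congr_ae (by filter_upwards [hwae] with y hy; rw [hy])
  simp only [hψw] at hv1 hv2 hsub1 hsub2
  have hGp : Integrable (fun p : Pt × Pt => G p.1 p.2)
      ((volume.restrict D).prod (volume.restrict D)) := by
    rw [Measure.prod_restrict, ← Measure.volume_eq_prod]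
    exact hG
  have hψi : Integrable (fun x => ∫ y in D, G x y * w y) (volume.restrict D) := by
    have h : Integrable (fun p : Pt × Pt => G p.1 p.2 * w p.2)
        ((volume.restrict D).prod (volume.restrict D)) :=
      hGp.mul_bdd (c := lam) (hwm.comp measurable_snd).aestronglyMeasurable
        (Eventually.of_forall fun p => hwC p.2)
    exact h.integral_prod_left
  obtain ⟨A1, hA1s, hA1, hA1ae, hA1v⟩ := exists_measurableSet_subset_ae_iff hD
    (nullMeasurableSet_lt (aemeasurable_const (b := ν1)) hψi.aemeasurable)
  obtain ⟨A2, hA2s, hA2, hA2ae, hA2v⟩ := exists_measurableSet_subset_ae_iff hD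
    (nullMeasurableSet_lt hψi.aemeasurable (aemeasurable_const (b := -ν2)))
  have hr1 : volume.real A1 = volume.real Ω1 := by rw [measureReal_def, hA1v, hv1, measureReal_def]
  have hr2 : volume.real A2 = volume.real Ω2 := by rw [measureReal_def, hA2v, hv2, measureReal_def]
  have hκ := eq_of_inK_indicator hΩ1 hΩ2 hΩ1B hΩ2B hB1D hB2D hBdisj (hform ▸ hmem)
  have hvK := inK_of_indicator hlam.le hA1 hA2 (hA1s.trans hsub1) (hA2s.trans hsub2) hB1D hB2D
  rw [hr1, hr2, ← hκ.1, ← hκ.2] at hvK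
  refine le_trans ?_ (hmax _ hvK)
  rw [energy_congr hwae]
  refine mul_le_mul_of_nonneg_left ?_ (by norm_num)
  refine quadratic_le_of_potential_le hGp hGsym hGpsd
    (((measurable_one.indicator hA1).sub (measurable_one.indicator hA2)).const_mul lam)
    hwm (C := lam) (fun x => ?_) hwC ?_
  · rw [abs_le]
    by_cases a : x ∈ A1 <;> by_cases b : x ∈ A2 <;> simp [a, b] <;> linarith
  · refine integral_mul_le_integral_mul_superlevel hψi hwm hlam.le hwC hA1 hA2 hA1ae hA2ae ?_ ?_
    · rw [measureReal_restrict_apply hA1, inter_eq_left.2 (hA1s.trans (sep_subset _ _)), hr1,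
        ← hlpos, ← hint (fun t => max t 0) (by fun_prop)]
      exact integral_congr_ae (by filter_upwards [hwae] with x hx; rw [hx])
    · rw [measureReal_restrict_apply hA2, inter_eq_left.2 (hA2s.trans (sep_subset _ _)), hr2,
        ← hlneg, ← hint (fun t => max (-t) 0) (by fun_prop)]
      exact integral_congr_ae (by filter_upwards [hwae] with x hx; rw [hx])
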